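/- For every n ≥ 1 and every k, the number of ascent sequences of length n with exactly k ascents equals the number of ascent sequences of length n with exactly k repeated entries (i.e., rep is an Eulerian statistic on ascent sequences). -/

import Mathlib

def ascN (s : List ℕ) : ℕ :=
  ((Finset.range (s.length - 1)).filter fun i => s.getD i 0 < s.getD (i+1) 0).card

def repN (s : List ℕ) : ℕ := s.length - s.dedup.length

def zeroN (s : List ℕ) : ℕ :=
  ((Finset.range s.length).filter fun i => s.getD i 0 = 0).card

def maxN (s : List ℕ) : ℕ :=
  ((Finset.range s.length).filter fun i => s.getD i 0 = i).card

def rminN (s : List ℕ) : ℕ :=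
  ((Finset.range s.length).filter fun i =>
    ∀ j ∈ Finset.range s.length, i < j → s.getD i 0 < s.getD j 0).card

/-- `s` is an inversion sequence: 0-indexed, `s i ≤ i` (i.e. 1-indexed `0 ≤ s_i < i`). -/
def IsInvSeq (s : List ℕ) : Prop := ∀ i < s.length, s.getD i 0 ≤ i

/-- `s` is an ascent sequence. -/
def IsAscSeq (s : List ℕ) : Prop :=
  IsInvSeq s ∧ ∀ i < s.length, s.getD i 0 ≤ ascN (s.take i) + 1

def AscSeqs (n : ℕ) : Set (List ℕ) := {s | IsAscSeq s ∧ s.length = n}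

lemma ascN_append_singleton {s : List ℕ} (hs : s ≠ []) (j : ℕ) :
    ascN (s ++ [j]) = ascN s + if s.getLastD 0 < j then 1 else 0 := by
  obtain ⟨l, a, rfl⟩ : ∃ l a, s = l ++ [a] :=
    ⟨s.dropLast, s.getLast hs, (List.dropLast_append_getLast hs).symm⟩
  have hlast : (l ++ [a]).getLastD 0 = a := by simp
  unfold ascN
  rw [hlast]
  have h1 : (l ++ [a] ++ [j]).length - 1 = l.length + 1 := by simp
  have h2 : (l ++ [a]).length - 1 = l.length := by simp
  rw [h1, h2, Finset.range_add_one, Finset.filter_insert]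
  have hfilter : (Finset.range l.length).filter
        (fun i => (l ++ [a] ++ [j]).getD i 0 < (l ++ [a] ++ [j]).getD (i + 1) 0) =
      (Finset.range l.length).filter
        (fun i => (l ++ [a]).getD i 0 < (l ++ [a]).getD (i + 1) 0) := by
    apply Finset.filter_congr
    intro i hi
    rw [Finset.mem_range] at hi
    rw [List.getD_append (l ++ [a]) [j] _ _ (by simp; omega),
      List.getD_append (l ++ [a]) [j] _ _ (by simp; omega)]
  have ha : (l ++ [a] ++ [j]).getD l.length 0 = a := by simp
  have hj : (l ++ [a] ++ [j]).getD (l.length + 1) 0 = j := by simp [List.getD]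
  rw [hfilter, ha, hj]
  split_ifs
  · rw [Finset.card_insert_of_notMem (by simp)]
  · rfl

/-- The ascent sequences of length `n + 1`, generated by appending letters. -/
def ascentSeqs : ℕ → Finset (List ℕ)
  | 0 => {[0]}
  | n + 1 => (ascentSeqs n).biUnion fun s =>
      (Finset.range (ascN s + 2)).image fun j => s ++ [j]

lemma sum_ascentSeqs_succ {M : Type*} [AddCommMonoid M] (n : ℕ) (f : List ℕ → M) :
    ∑ s ∈ ascentSeqs (n + 1), f s =
      ∑ s ∈ ascentSeqs n, ∑ j ∈ Finset.range (ascN s + 2), f (s ++ [j]) := by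
  rw [ascentSeqs, Finset.sum_biUnion]
  · refine Finset.sum_congr rfl fun s _ => ?_
    rw [Finset.sum_image]
    intro a _ b _ h
    simpa using h
  · intro s _ s' _ hne
    rw [Function.onFun, Finset.disjoint_left]
    intro x hx hx'
    simp only [Finset.mem_image] at hx hx'
    obtain ⟨j, _, rfl⟩ := hx
    obtain ⟨j', _, h⟩ := hx'
    exact hne (List.append_inj_left' h rfl).symm

lemma length_of_mem_ascentSeqs {n : ℕ} {s : List ℕ} (hs : s ∈ ascentSeqs n) :
    s.length = n + 1 := by
  induction n generalizing s with
  | zero => simp_all [ascentSeqs]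
  | succ n ih =>
    simp only [ascentSeqs, Finset.mem_biUnion, Finset.mem_image] at hs
    obtain ⟨t, ht, j, _, rfl⟩ := hs
    simp [ih ht]

lemma ne_nil_of_mem_ascentSeqs {n : ℕ} {s : List ℕ} (hs : s ∈ ascentSeqs n) : s ≠ [] := by
  rintro rfl
  simpa using length_of_mem_ascentSeqs hs

lemma le_ascN_of_mem_ascentSeqs {n : ℕ} {s : List ℕ} (hs : s ∈ ascentSeqs n) {x : ℕ}
    (hx : x ∈ s) : x ≤ ascN s := by
  induction n generalizing s x with
  | zero => simp_all [ascentSeqs]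
  | succ n ih =>
    simp only [ascentSeqs, Finset.mem_biUnion, Finset.mem_image, Finset.mem_range] at hs
    obtain ⟨t, ht, j, hj, rfl⟩ := hs
    have hne := ne_nil_of_mem_ascentSeqs ht
    have hlast : t.getLastD 0 ≤ ascN t := by
      rw [List.getLastD_eq_getLast?, List.getLast?_eq_some_getLast hne]
      exact ih ht (List.getLast_mem hne)
    rw [ascN_append_singleton hne]
    rcases List.mem_append.1 hx with hx | hx
    · exact (ih ht hx).trans (Nat.le_add_right _ _)
    · obtain rfl : x = j := by simpa using hx
      split_ifs <;> omega

lemma ascN_lt_length {s : List ℕ} (hs : s ≠ []) : ascN s < s.length := by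
  have h : ascN s ≤ s.length - 1 :=
    (Finset.card_filter_le _ _).trans_eq (Finset.card_range _)
  have := List.length_pos_of_ne_nil hs
  omega

lemma isAscSeq_append_singleton {s : List ℕ} (hs : s ≠ []) (j : ℕ) :
    IsAscSeq (s ++ [j]) ↔ IsAscSeq s ∧ j < ascN s + 2 := by
  have hlen := ascN_lt_length hs
  have hlt : ∀ i < s.length, (s ++ [j]).getD i 0 = s.getD i 0 ∧
      (s ++ [j]).take i = s.take i := fun i hi =>
    ⟨List.getD_append _ _ _ _ hi, List.take_append_of_le_length hi.le⟩
  have heq : (s ++ [j]).getD s.length 0 = j ∧ (s ++ [j]).take s.length = s := by simp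
  constructor
  · rintro ⟨h1, h2⟩
    refine ⟨⟨fun i hi => ?_, fun i hi => ?_⟩, ?_⟩
    · simpa only [(hlt i hi).1] using h1 i (by simp; omega)
    · simpa only [(hlt i hi).1, (hlt i hi).2] using h2 i (by simp; omega)
    · have := h2 s.length (by simp)
      rw [heq.1, heq.2] at this
      omega
  · rintro ⟨⟨h1, h2⟩, h3⟩
    refine ⟨fun i hi => ?_, fun i hi => ?_⟩ <;>
      rcases Nat.lt_succ_iff_lt_or_eq.1 (by simpa using hi : i < s.length + 1) with hi | rfl
    · rw [(hlt i hi).1]; exact h1 i hi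
    · rw [heq.1]; omega
    · rw [(hlt i hi).1, (hlt i hi).2]; exact h2 i hi
    · rw [heq.1, heq.2]; omega

lemma mem_ascentSeqs {n : ℕ} {s : List ℕ} :
    s ∈ ascentSeqs n ↔ IsAscSeq s ∧ s.length = n + 1 := by
  induction n generalizing s with
  | zero =>
    simp only [ascentSeqs, Finset.mem_singleton]
    constructor
    · rintro rfl
      simp [IsAscSeq, IsInvSeq]
    · rintro ⟨h, hl⟩
      obtain ⟨a, rfl⟩ := List.length_eq_one_iff.1 hl
      simpa using h.1 0 (by simp)
  | succ n ih =>
    simp only [ascentSeqs, Finset.mem_biUnion, Finset.mem_image, Finset.mem_range]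
    constructor
    · rintro ⟨t, ht, j, hj, rfl⟩
      have hne := ne_nil_of_mem_ascentSeqs ht
      exact ⟨(isAscSeq_append_singleton hne j).2 ⟨(ih.1 ht).1, hj⟩, by simp [(ih.1 ht).2]⟩
    · rintro ⟨h, hl⟩
      have hs : s ≠ [] := by rintro rfl; simp at hl
      have hdecomp := List.dropLast_append_getLast hs
      have hlen : s.dropLast.length = n + 1 := by simp [hl]
      have hne : s.dropLast ≠ [] := by intro h0; simp [h0] at hlen
      rw [← hdecomp] at h
      have := (isAscSeq_append_singleton hne _).1 h
      exact ⟨_, ih.2 ⟨this.1, hlen⟩, _, this.2, hdecomp⟩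

lemma repN_eq (s : List ℕ) : repN s = s.length - s.toFinset.card := by
  rw [repN, List.card_toFinset]

/-- Each first occurrence of a letter weighs `g` and each repeated one `r`. -/
def letterWeight {R : Type*} [CommRing R] (r g : R) (s : List ℕ) : R :=
  r ^ repN s * g ^ s.toFinset.card

lemma letterWeight_append_singleton {R : Type*} [CommRing R] (r g : R) (s : List ℕ) (j : ℕ) :
    letterWeight r g (s ++ [j]) = (if j ∈ s then r else g) * letterWeight r g s := by
  have hcard := List.toFinset_card_le s
  have hset : (s ++ [j]).toFinset = insert j s.toFinset := by
    ext; simp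
  unfold letterWeight
  rw [repN_eq, repN_eq, hset]
  split_ifs with h
  · rw [Finset.insert_eq_of_mem (by simpa using h)]
    have : (s ++ [j]).length - s.toFinset.card = s.length - s.toFinset.card + 1 := by
      simp; omega
    rw [this]; ring
  · rw [Finset.card_insert_of_notMem (by simpa using h)]
    have : (s ++ [j]).length - (s.toFinset.card + 1) = s.length - s.toFinset.card := by
      simp
    rw [this]; ring

/-- The weight of `s` followed by an arbitrary weakly decreasing word in letters below `k`. -/
def tailWeight {R : Type*} [CommRing R] (r g a b : R) (s : List ℕ) (k : ℕ) : R :=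
  letterWeight r g s * ∏ j ∈ Finset.range k, if j ∈ s then a else b

lemma tailWeight_succ {R : Type*} [CommRing R] {r g y a : R} (ha : a * (1 + y * r) = 1)
    (s : List ℕ) (k : ℕ) :
    tailWeight r g a (1 - y * g * a) s (k + 1) = tailWeight r g a (1 - y * g * a) s k
      - y * tailWeight r g a (1 - y * g * a) (s ++ [k]) (k + 1) := by
  have hprod : ∏ j ∈ Finset.range k, (if j ∈ s ++ [k] then a else 1 - y * g * a) =
      ∏ j ∈ Finset.range k, (if j ∈ s then a else 1 - y * g * a) := by
    refine Finset.prod_congr rfl fun j hj => ?_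
    have : j ≠ k := (Finset.mem_range.1 hj).ne
    simp [this]
  unfold tailWeight
  rw [Finset.prod_range_succ, Finset.prod_range_succ, hprod, letterWeight_append_singleton]
  simp only [List.mem_append, List.mem_singleton, or_true, if_true]
  split_ifs
  · linear_combination (letterWeight r g s *
      ∏ j ∈ Finset.range k, if j ∈ s then a else 1 - y * g * a) * ha
  · ring

lemma tailWeight_eq_sub_sum {R : Type*} [CommRing R] {r g y a : R} (ha : a * (1 + y * r) = 1)
    (s : List ℕ) (k : ℕ) :
    tailWeight r g a (1 - y * g * a) s k = letterWeight r g s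
      - y * ∑ j ∈ Finset.range k, tailWeight r g a (1 - y * g * a) (s ++ [j]) (j + 1) := by
  induction k with
  | zero => simp [tailWeight]
  | succ k ih => rw [tailWeight_succ ha, ih, Finset.sum_range_succ]; ring

lemma tailWeight_full {R : Type*} [CommRing R] (r g a b : R) {n : ℕ} {s : List ℕ}
    (hs : s ∈ ascentSeqs n) :
    tailWeight r g a b s (ascN s + 2) =
      letterWeight r g s * (a ^ s.toFinset.card * b ^ (ascN s + 2 - s.toFinset.card)) := by
  have hsub : s.toFinset ⊆ Finset.range (ascN s + 2) := fun x hx =>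
    Finset.mem_range.2 (by have := le_ascN_of_mem_ascentSeqs hs (List.mem_toFinset.1 hx); omega)
  have h1 : (Finset.range (ascN s + 2)).filter (fun j => j ∈ s) = s.toFinset := by
    ext x
    simp only [Finset.mem_filter, List.mem_toFinset, and_iff_right_iff_imp]
    exact fun hx => hsub (List.mem_toFinset.2 hx)
  rw [tailWeight, Finset.prod_ite, Finset.prod_const, Finset.prod_const, Finset.filter_not, h1,
    Finset.card_sdiff_of_subset hsub, Finset.card_range]

lemma card_le_ascN_succ {n : ℕ} {s : List ℕ} (hs : s ∈ ascentSeqs n) :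
    s.toFinset.card ≤ ascN s + 1 := by
  have hsub : s.toFinset ⊆ Finset.range (ascN s + 1) := fun x hx =>
    Finset.mem_range.2 (Nat.lt_succ_of_le (le_ascN_of_mem_ascentSeqs hs (List.mem_toFinset.1 hx)))
  simpa using Finset.card_le_card hsub

lemma sum_letterWeight_functional_equation {R : Type*} [CommRing R] {r g z a : R}
    (ha : a * (1 + (z - 1) * r) = 1) {N : ℕ} (hN : ∀ i j, i + j = N + 1 → r ^ i * g ^ j = 0) :
    ∑ n ∈ Finset.range N, ∑ s ∈ ascentSeqs n, letterWeight r g s * z ^ (ascN s + 1) =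
      z * ∑ n ∈ Finset.range N, ∑ s ∈ ascentSeqs n, z ^ (ascN s + 1) * (letterWeight r g s *
        (a ^ s.toFinset.card * (1 - (z - 1) * g * a) ^ (ascN s + 2 - s.toFinset.card)))
      - (z - 1) * (z * g * a) := by
  set y := z - 1 with hy
  set T := tailWeight r g a (1 - y * g * a) with hT
  set Y : ℕ → R := fun n => ∑ s ∈ ascentSeqs n, z ^ (ascN s + 1) * T s (s.getLastD 0 + 1) with hY
  have step : ∀ n, ∑ s ∈ ascentSeqs n, letterWeight r g s * z ^ (ascN s + 1) =
      z * ∑ s ∈ ascentSeqs n, z ^ (ascN s + 1) * (letterWeight r g s *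
        (a ^ s.toFinset.card * (1 - y * g * a) ^ (ascN s + 2 - s.toFinset.card)))
      + y * (Y (n + 1) - Y n) := by
    intro n
    simp only [hY]
    rw [sum_ascentSeqs_succ, ← Finset.sum_sub_distrib, Finset.mul_sum, Finset.mul_sum,
      ← Finset.sum_add_distrib]
    refine Finset.sum_congr rfl fun s hs => ?_
    rw [← tailWeight_full r g a _ hs, ← hT]
    have hne := ne_nil_of_mem_ascentSeqs hs
    have hlast : s.getLastD 0 ≤ ascN s := by
      rw [List.getLastD_eq_getLast?, List.getLast?_eq_some_getLast hne]
      exact le_ascN_of_mem_ascentSeqs hs (List.getLast_mem hne)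
    have hfull : T s (ascN s + 2) = _ := tailWeight_eq_sub_sum ha s (ascN s + 2)
    have hown : T s (s.getLastD 0 + 1) = _ := tailWeight_eq_sub_sum ha s (s.getLastD 0 + 1)
    have hsplit : ∀ f : ℕ → R, ∑ j ∈ Finset.range (ascN s + 2), f j =
        ∑ j ∈ Finset.range (s.getLastD 0 + 1), f j +
          ∑ j ∈ Finset.Ico (s.getLastD 0 + 1) (ascN s + 2), f j := fun f =>
      (Finset.sum_range_add_sum_Ico f (by omega)).symm
    have hlow : ∑ j ∈ Finset.range (s.getLastD 0 + 1),
          z ^ (ascN (s ++ [j]) + 1) * T (s ++ [j]) ((s ++ [j]).getLastD 0 + 1) =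
        z ^ (ascN s + 1) * ∑ j ∈ Finset.range (s.getLastD 0 + 1), T (s ++ [j]) (j + 1) := by
      rw [Finset.mul_sum]
      refine Finset.sum_congr rfl fun j hj => ?_
      rw [ascN_append_singleton hne, if_neg (by have := Finset.mem_range.1 hj; omega)]
      simp
    have hhigh : ∑ j ∈ Finset.Ico (s.getLastD 0 + 1) (ascN s + 2),
          z ^ (ascN (s ++ [j]) + 1) * T (s ++ [j]) ((s ++ [j]).getLastD 0 + 1) =
        z ^ (ascN s + 2) *
          ∑ j ∈ Finset.Ico (s.getLastD 0 + 1) (ascN s + 2), T (s ++ [j]) (j + 1) := by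
      rw [Finset.mul_sum]
      refine Finset.sum_congr rfl fun j hj => ?_
      rw [ascN_append_singleton hne, if_pos (by have := (Finset.mem_Ico.1 hj).1; omega)]
      simp
    rw [hsplit, hlow, hhigh, hfull, hown, hsplit (fun j => _)]
    rw [hy]
    ring
  have hY0 : Y 0 = z * g * a := by
    have : repN [0] = 0 := by simp [repN]
    have : ascN [0] = 0 := by simp [ascN]
    simp [ascentSeqs, tailWeight, letterWeight, *]
    ring
  have hYN : Y N = 0 := by
    refine Finset.sum_eq_zero fun s hs => ?_
    have : letterWeight r g s = 0 := by
      refine hN _ _ ?_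
      have := List.toFinset_card_le s
      rw [repN_eq, ← length_of_mem_ascentSeqs hs]
      omega
    simp [hT, tailWeight, this]
  rw [Finset.sum_congr rfl fun n _ => step n, Finset.sum_add_distrib, ← Finset.mul_sum,
    ← Finset.mul_sum, Finset.sum_range_sub, hYN, hY0]
  ring

section QSeries

variable {A : Type*} [CommRing A]

/-- The finite `q`-Pochhammer symbol `(1 - q) (1 - q ^ 2) ⋯ (1 - q ^ m)`. -/
def qPoch (q : A) (m : ℕ) : A := ∏ i ∈ Finset.range m, (1 - q ^ (i + 1))

lemma qPoch_succ (q : A) (m : ℕ) : qPoch q (m + 1) = qPoch q m * (1 - q ^ (m + 1)) :=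
  Finset.prod_range_succ _ _

lemma qPoch_eq_zero {q : A} {N m : ℕ} (hq : (1 - q) ^ N = 0) (h : N ≤ m) : qPoch q m = 0 := by
  have : (1 - q) ^ m ∣ qPoch q m := by
    rw [qPoch, ← Finset.card_range m, ← Finset.prod_const, Finset.card_range]
    exact Finset.prod_dvd_prod_of_dvd _ _ fun i _ => one_sub_dvd_one_sub_pow q (i + 1)
  rwa [pow_eq_zero_of_le h hq, zero_dvd_iff] at this

lemma isNilpotent_mul_one_sub_pow {q : A} (hq : IsNilpotent (1 - q)) (z : A) (m : ℕ) :
    IsNilpotent (z * (1 - q ^ m)) := by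
  obtain ⟨c, hc⟩ := one_sub_dvd_one_sub_pow q m
  rw [hc]
  exact (Commute.all _ _).isNilpotent_mul_left ((Commute.all _ _).isNilpotent_mul_right hq)

/-- The inverse of `1 - z (1 - q ^ m)`. -/
noncomputable def qKernel (q z : A) (m : ℕ) : A := Ring.inverse (1 - z * (1 - q ^ m))

lemma qKernel_mul {q : A} (hq : IsNilpotent (1 - q)) (z : A) (m : ℕ) :
    (1 - z * (1 - q ^ m)) * qKernel q z m = 1 :=
  Ring.mul_inverse_cancel _ (isNilpotent_mul_one_sub_pow hq z m).isUnit_one_sub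

lemma qKernel_unique {q : A} (hq : IsNilpotent (1 - q)) {z x : A} {m : ℕ}
    (hx : (1 - z * (1 - q ^ m)) * x = 1) : x = qKernel q z m := by
  linear_combination (-x) * qKernel_mul hq z m + qKernel q z m * hx

lemma isUnit_of_isNilpotent_one_sub {q : A} (hq : IsNilpotent (1 - q)) : IsUnit q := by
  simpa using hq.isUnit_one_sub

/-- The truncation of the series of all `q ^ m (1 - q) ⋯ (1 - q ^ m) / (1 - z (1 - q ^ m))`. -/
noncomputable def qSum (q z : A) (N : ℕ) : A :=
  ∑ m ∈ Finset.range N, q ^ (m + 1) * qPoch q (m + 1) * qKernel q z (m + 1)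

lemma one_add_qSum {q : A} {N : ℕ} (hq : (1 - q) ^ N = 0) (z : A) :
    1 + qSum q z N = ∑ m ∈ Finset.range N, q ^ m * qPoch q m * qKernel q z m := by
  have h := Finset.sum_range_succ' (fun m => q ^ m * qPoch q m * qKernel q z m) N
  rw [Finset.sum_range_succ, qPoch_eq_zero hq le_rfl] at h
  have h0 : qPoch q 0 = 1 := rfl
  have h1 : qKernel q z 0 = 1 := by simp [qKernel]
  rw [h0, h1] at h
  rw [qSum]
  linear_combination -h

lemma qSum_recurrence {q : A} {N : ℕ} (hq : (1 - q) ^ N = 0) (z : A) :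
    (q + (1 - q) * z) * (1 + qSum q z N) =
      1 + z * ∑ m ∈ Finset.range N, q ^ m * qPoch q (m + 1) * qKernel q z m := by
  have hterm : ∀ m, (q + (1 - q) * z) * (q ^ m * qPoch q m * qKernel q z m) -
      z * (q ^ m * qPoch q (m + 1) * qKernel q z m) = qPoch q m - qPoch q (m + 1) := by
    intro m
    rw [qPoch_succ]
    linear_combination (q ^ (m + 1) * qPoch q m) * qKernel_mul ⟨N, hq⟩ z m
  have hsum := Finset.sum_range_sub' (qPoch q) N
  rw [← Finset.sum_congr rfl fun m _ => hterm m, Finset.sum_sub_distrib, ← Finset.mul_sum,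
    ← Finset.mul_sum, ← one_add_qSum hq, qPoch_eq_zero hq le_rfl] at hsum
  have h0 : qPoch q 0 = 1 := rfl
  rw [h0] at hsum
  linear_combination hsum

lemma qSum_functional_equation {q : A} {N : ℕ} (hq : (1 - q) ^ N = 0) {z a : A}
    (ha : a * (1 + (z - 1) * (1 - q)) = 1) :
    z * qSum q z N =
      (z * a) * ((z * a) * qSum q (z * a) N) - (z - 1) * (1 - q) * (z * a) := by
  have hnil : IsNilpotent (1 - q) := ⟨N, hq⟩
  have hker : ∀ m, a * q * qKernel q (z * a) (m + 1) = qKernel q z m := fun m => by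
    refine qKernel_unique hnil ?_
    linear_combination qKernel_mul hnil (z * a) (m + 1) + qKernel q (z * a) (m + 1) * ha
  have hsum : a * qSum q (z * a) N =
      ∑ m ∈ Finset.range N, q ^ m * qPoch q (m + 1) * qKernel q z m := by
    rw [qSum, Finset.mul_sum]
    refine Finset.sum_congr rfl fun m _ => ?_
    rw [← hker]
    ring
  have h := qSum_recurrence hq z
  rw [← hsum] at h
  linear_combination (z * a) * h - z * qSum q z N * ha

/-- The complete homogeneous symmetric polynomial of degree `k` at `q, q ^ 2, …, q ^ m`. -/
def qHomog (q : A) : ℕ → ℕ → A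
  | 0, _ => 1
  | _ + 1, 0 => 0
  | k + 1, m + 1 => qHomog q (k + 1) m + q ^ (m + 1) * qHomog q k (m + 1)

lemma one_sub_pow_mul_qHomog (q : A) (k m : ℕ) :
    (1 - q ^ (k + 1)) * qHomog q (k + 1) m = q * (1 - q ^ (m + k)) * qHomog q k m := by
  induction k generalizing m with
  | zero =>
    induction m with
    | zero => simp [qHomog]
    | succ m ih =>
      simp only [qHomog] at ih ⊢
      linear_combination ih
  | succ k ihk =>
    induction m with
    | zero => simp [qHomog]
    | succ m ih =>
      have h := ihk (m + 1)
      have h1 : qHomog q (k + 1) (m + 1) =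
        qHomog q (k + 1) m + q ^ (m + 1) * qHomog q k (m + 1) := by rw [qHomog]
      have h2 : qHomog q (k + 1 + 1) (m + 1) =
        qHomog q (k + 1 + 1) m + q ^ (m + 1) * qHomog q (k + 1) (m + 1) := by rw [qHomog]
      rw [h2]
      linear_combination ih + q ^ (m + 1) * h - q * (1 - q ^ (m + k + 1)) * h1

lemma pow_mul_sum_qPoch_qHomog {q : A} {N : ℕ} (hq : (1 - q) ^ N = 0) (k : ℕ) :
    q ^ (k + 1) * ∑ m ∈ Finset.range N, q ^ (m + 1) * qPoch q (m + 1) * qHomog q k (m + 1) =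
      1 - q := by
  have hend : qPoch q (N + 1) = 0 := qPoch_eq_zero hq (Nat.le_succ N)
  induction k with
  | zero =>
    have h := Finset.sum_range_sub' (fun m => qPoch q (m + 1)) N
    have h1 : qPoch q 1 = 1 - q := by simp [qPoch]
    rw [hend, zero_add, h1, sub_zero] at h
    rw [← h, Finset.mul_sum]
    refine Finset.sum_congr rfl fun m _ => ?_
    rw [qPoch_succ q (m + 1), qHomog]
    ring
  | succ k ih =>
    rw [← ih, pow_succ, mul_assoc]
    congr 1
    have h := Finset.sum_range_sub' (fun m => qPoch q (m + 1) * qHomog q (k + 1) m) N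
    rw [hend, qHomog, mul_zero, zero_mul, sub_zero] at h
    rw [← sub_eq_zero, Finset.mul_sum, ← Finset.sum_sub_distrib, ← h]
    refine Finset.sum_congr rfl fun m _ => ?_
    rw [qPoch_succ q (m + 1), qHomog]
    ring

/-- The deformation of `qSum` by `qHomog`. -/
noncomputable def qHomogSum (q u : A) (N k : ℕ) : A :=
  u ^ k * ∑ m ∈ Finset.range N,
    q ^ (m + 1) * qPoch q (m + 1) * qKernel q u (m + 1) * qHomog q k (m + 1)

lemma qHomogSum_zero (q u : A) (N : ℕ) : qHomogSum q u N 0 = qSum q u N := by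
  simp [qHomogSum, qSum, qHomog]

lemma qHomogSum_recurrence {q : A} {N : ℕ} (hq : (1 - q) ^ N = 0) (u : A) (k : ℕ) :
    qHomogSum q u N (k + 1) * (1 - q ^ (k + 1)) + (1 - q) * u ^ k =
      qHomogSum q u N k * (u * q + (1 - u) * q ^ (k + 1)) := by
  rw [← pow_mul_sum_qPoch_qHomog hq k]
  simp only [qHomogSum, Finset.mul_sum, Finset.sum_mul]
  rw [← Finset.sum_add_distrib]
  refine Finset.sum_congr rfl fun m _ => ?_
  linear_combination
    (u ^ (k + 1) * (q ^ (m + 1) * qPoch q (m + 1) * qKernel q u (m + 1))) *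
      one_sub_pow_mul_qHomog q k (m + 1)
    - (u ^ k * q ^ (k + 1) * q ^ (m + 1) * qPoch q (m + 1) * qHomog q k (m + 1)) *
      qKernel_mul ⟨N, hq⟩ u (m + 1)

end QSeries

section GeneratingFunctions

variable {A : Type*} [CommRing A]

lemma repN_add_card (s : List ℕ) : repN s + s.toFinset.card = s.length := by
  rw [repN_eq, Nat.sub_add_cancel (List.toFinset_card_le s)]

lemma sum_ascN_eq_qSum {q z : A} {N : ℕ} (hq : (1 - q) ^ N = 0) (hz : IsNilpotent z) :
    ∑ n ∈ Finset.range N, ∑ s ∈ ascentSeqs n, (1 - q) ^ (n + 1) * z ^ (ascN s + 1) =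
      z * qSum q z N := by
  have hnil : IsNilpotent (1 - q) := ⟨N, hq⟩
  set W : A → A := fun z =>
    ∑ n ∈ Finset.range N, ∑ s ∈ ascentSeqs n, (1 - q) ^ (n + 1) * z ^ (ascN s + 1) with hW
  have hfe : ∀ z, ∃ a, W z - z * qSum q z N =
      (z * a) * (W (z * a) - (z * a) * qSum q (z * a) N) := by
    intro z
    have hunit : IsUnit (1 + (z - 1) * (1 - q)) :=
      ((Commute.all _ _).isNilpotent_mul_left hnil).isUnit_one_add
    obtain ⟨a, ha⟩ := hunit.exists_left_inv
    refine ⟨a, ?_⟩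
    have hpow : ∀ i j, i + j = N + 1 → (1 - q) ^ i * (1 - q) ^ j = 0 := fun i j hij => by
      rw [← pow_add, hij, pow_succ, hq, zero_mul]
    have hmaster := sum_letterWeight_functional_equation ha hpow
    have hb : 1 - (z - 1) * (1 - q) * a = a := by linear_combination -ha
    have hweight : ∀ n, ∀ s ∈ ascentSeqs n, letterWeight (1 - q) (1 - q) s = (1 - q) ^ (n + 1) :=
      fun n s hs => by
        rw [letterWeight, ← pow_add, repN_add_card, length_of_mem_ascentSeqs hs]
    have hleft : W z = ∑ n ∈ Finset.range N, ∑ s ∈ ascentSeqs n,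
        letterWeight (1 - q) (1 - q) s * z ^ (ascN s + 1) :=
      Finset.sum_congr rfl fun n _ => Finset.sum_congr rfl fun s hs => by rw [hweight n s hs]
    have hright : a * W (z * a) = ∑ n ∈ Finset.range N, ∑ s ∈ ascentSeqs n,
        z ^ (ascN s + 1) * (letterWeight (1 - q) (1 - q) s * (a ^ s.toFinset.card *
          (1 - (z - 1) * (1 - q) * a) ^ (ascN s + 2 - s.toFinset.card))) := by
      simp only [hW, Finset.mul_sum]
      refine Finset.sum_congr rfl fun n _ => Finset.sum_congr rfl fun s hs => ?_
      have hd : s.toFinset.card ≤ ascN s + 2 := (card_le_ascN_succ hs).trans (by omega)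
      rw [hb, ← pow_add, Nat.add_sub_cancel' hd, hweight n s hs]
      ring
    rw [← hleft, ← hright] at hmaster
    linear_combination hmaster - qSum_functional_equation hq ha
  have hdvd : ∀ j z, z ^ j ∣ W z - z * qSum q z N := by
    intro j
    induction j with
    | zero => simp
    | succ j ih =>
      intro z
      obtain ⟨a, ha⟩ := hfe z
      rw [ha]
      refine dvd_trans ?_ (mul_dvd_mul_left (z * a) (ih (z * a)))
      rw [← pow_succ', mul_pow]
      exact dvd_mul_right _ _
  obtain ⟨K, hK⟩ := hz
  have h := hdvd K z
  rw [hK, zero_dvd_iff, sub_eq_zero] at h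
  exact h

open PowerSeries in
lemma exists_repN_deformation {q : A} {N : ℕ} (hq : (1 - q) ^ N = 0) (u : A) :
    ∃ b : ℕ → A,
      b 0 = ∑ n ∈ Finset.range N, ∑ s ∈ ascentSeqs n, (1 - q) ^ (n + 1) * u ^ repN s ∧
      ∀ k, b (k + 1) * (1 - q ^ (k + 1)) + (1 - q) * u ^ k =
        b k * (u * q + (1 - u) * q ^ (k + 1)) := by
  have hgeom : ∀ v : A, PowerSeries.mk (fun n => v ^ n) * (1 - C v * X) = 1 := fun v => by
    have h := congrArg (rescale v) (mk_one_mul_one_sub_eq_one A)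
    simpa [rescale_mk, rescale_X] using h
  have hC : ∀ c : A, rescale q (C c) = C c := fun c => by
    ext n
    rcases n with - | n <;> simp [coeff_rescale, coeff_C]
  set G : A⟦X⟧ := PowerSeries.mk fun n => u ^ n with hG
  set ρ : A⟦X⟧ := PowerSeries.mk fun n => (u - 1) ^ n with hρ
  set G' : A⟦X⟧ := rescale q G with hG'
  have h1 : G * (1 - C u * X) = 1 := hgeom u
  have h2 : ρ * (1 - C (u - 1) * X) = 1 := hgeom (u - 1)
  have h3 : G' * (1 - C u * (C q * X)) = 1 := by
    have h := congrArg (rescale q) h1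
    simpa [rescale_X, hC] using h
  rw [map_sub, map_one] at h2
  clear_value G' ρ
  set z : A⟦X⟧ := (1 + (1 - C u) * X) * G with hz
  set a : A⟦X⟧ := (1 - C u * X) * G' with ha
  clear_value z a
  have hz1 : z - 1 = X * G := by linear_combination hz + h1
  have hzρ : z * ρ = G := by linear_combination ρ * hz + G * h2
  have haG : a * G = G' := by linear_combination G * ha + G' * h1
  have hz' : rescale q z = (1 + (1 - C u) * (C q * X)) * G' := by
    simp [hz, rescale_X, hC, hG']
  have hzz : z * (1 - (z - 1) * (C (1 - q) * ρ) * a) = rescale q z := by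
    rw [hz', hz1]
    have : C (1 - q) = 1 - (C q : A⟦X⟧) := by simp
    rw [this]
    linear_combination -(1 - C q) * X * G * (a * hzρ + haG) + hz
      - (1 + (1 - C u) * X) * G * h3 + (1 + (1 - C u) * (C q * X)) * G' * h1
  have hinv : a * (1 + (z - 1) * C ((1 - q) * u)) = 1 := by
    rw [hz1]
    have : C ((1 - q) * u) = (1 - (C q : A⟦X⟧)) * C u := by simp
    rw [this]
    linear_combination (1 - C q) * C u * X * haG + ha + h3
  have hpow : ∀ i j, i + j = N + 1 →
      (C ((1 - q) * u) : A⟦X⟧) ^ i * (C (1 - q) * ρ) ^ j = 0 := fun i j hij => by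
    have h : (C (1 - q) : A⟦X⟧) ^ i * C (1 - q) ^ j = 0 := by
      rw [← pow_add, hij, pow_succ, ← map_pow, hq, map_zero, zero_mul]
    rw [map_mul, mul_pow, mul_pow]
    linear_combination C u ^ i * ρ ^ j * h
  set B : A⟦X⟧ := ∑ n ∈ Finset.range N, ∑ s ∈ ascentSeqs n,
    C ((1 - q) ^ (n + 1) * u ^ repN s) *
      (G ^ s.toFinset.card * z ^ (ascN s + 1 - s.toFinset.card)) with hB
  have hmaster := sum_letterWeight_functional_equation hinv hpow
  have hweight : ∀ n, ∀ s ∈ ascentSeqs n,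
      letterWeight (C ((1 - q) * u)) (C (1 - q) * ρ) s =
        C ((1 - q) ^ (n + 1) * u ^ repN s) * ρ ^ s.toFinset.card := fun n s hs => by
    rw [letterWeight, ← length_of_mem_ascentSeqs hs, ← repN_add_card s]
    simp only [map_mul, map_pow]
    ring
  have hleft : ∑ n ∈ Finset.range N, ∑ s ∈ ascentSeqs n,
      letterWeight (C ((1 - q) * u)) (C (1 - q) * ρ) s * z ^ (ascN s + 1) = B := by
    refine Finset.sum_congr rfl fun n _ => Finset.sum_congr rfl fun s hs => ?_
    have hd := card_le_ascN_succ hs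
    obtain ⟨e, he⟩ := Nat.exists_eq_add_of_le hd
    rw [hweight n s hs, ← hzρ, he, Nat.add_sub_cancel_left]
    ring
  have hright : z * ∑ n ∈ Finset.range N, ∑ s ∈ ascentSeqs n,
      z ^ (ascN s + 1) * (letterWeight (C ((1 - q) * u)) (C (1 - q) * ρ) s *
        (a ^ s.toFinset.card * (1 - (z - 1) * (C (1 - q) * ρ) * a) ^
          (ascN s + 2 - s.toFinset.card))) = rescale q z * rescale q B := by
    simp only [hB, map_sum, Finset.mul_sum]
    refine Finset.sum_congr rfl fun n _ => Finset.sum_congr rfl fun s hs => ?_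
    have hd := card_le_ascN_succ hs
    have hresc : ∀ (c : A) (d e : ℕ), rescale q (C c * (G ^ d * z ^ e)) =
        C c * (G' ^ d * (rescale q z) ^ e) := fun c d e => by
      rw [map_mul, map_mul, map_pow, map_pow, hC, hG']
    rw [hresc, hweight n s hs, ← haG, ← hzρ]
    obtain ⟨e, he⟩ := Nat.exists_eq_add_of_le hd
    have he1 : ascN s + 1 - s.toFinset.card = e := by omega
    have he2 : ascN s + 2 - s.toFinset.card = e + 1 := by omega
    rw [he1, he2, he, ← hzz]
    generalize 1 - (z - 1) * (C (1 - q) * ρ) * a = w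
    ring
  rw [hleft, hright] at hmaster
  have hfe : (1 - C u * (C q * X)) * B = (1 + (1 - C u) * (C q * X)) * rescale q B
      - C (1 - q) * X * G := by
    rw [hz', hz1] at hmaster
    linear_combination (1 - C u * (C q * X)) * hmaster +
      (1 + (1 - C u) * (C q * X)) * rescale q B * h3 - C (1 - q) * X * G * h3 -
      (1 - C u * (C q * X)) * C (1 - q) * X * G * (a * hzρ + haG)
  refine ⟨fun k => coeff k B, ?_, fun k => ?_⟩
  · have hG0 : constantCoeff G = 1 := by simp [hG]
    have hz0 : constantCoeff z = 1 := by simp [hz, hG0]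
    simp [hB, hG0, hz0]
  · have h := congrArg (coeff (k + 1)) hfe
    have hl : (1 - C u * (C q * X)) * B = B - C (u * q) * (X * B) := by
      rw [map_mul]; ring
    have hr : (1 + (1 - C u) * (C q * X)) * rescale q B - C (1 - q) * X * G =
        rescale q B + C ((1 - u) * q) * (X * rescale q B) - C (1 - q) * (X * G) := by
      simp only [map_mul, map_sub, map_one]; ring
    rw [hl, hr, map_sub, map_sub, map_add] at h
    simp only [coeff_C_mul, coeff_succ_X_mul, coeff_rescale, hG, coeff_mk] at h
    linear_combination h

lemma sum_repN_eq_qSum {q : A} {N : ℕ} (hq : (1 - q) ^ N = 0) (u : A) :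
    ∑ n ∈ Finset.range N, ∑ s ∈ ascentSeqs n, (1 - q) ^ (n + 1) * u ^ repN s = qSum q u N := by
  obtain ⟨b, hb0, hb⟩ := exists_repN_deformation hq u
  have hnil : IsNilpotent (1 - q) := ⟨N, hq⟩
  have hdvd : ∀ j k, (1 - q) ^ j ∣ b k - qHomogSum q u N k := by
    intro j
    induction j with
    | zero => simp
    | succ j ih =>
      intro k
      have hunit : IsUnit (u * q + (1 - u) * q ^ (k + 1)) := by
        have h := (isUnit_of_isNilpotent_one_sub hnil).mul
          (isNilpotent_mul_one_sub_pow hnil (1 - u) k).isUnit_one_sub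
        convert h using 1
        ring
      rw [← hunit.dvd_mul_right]
      have heq : (b k - qHomogSum q u N k) * (u * q + (1 - u) * q ^ (k + 1)) =
          (b (k + 1) - qHomogSum q u N (k + 1)) * (1 - q ^ (k + 1)) := by
        linear_combination qHomogSum_recurrence hq u k - hb k
      rw [heq, pow_succ]
      exact mul_dvd_mul (ih (k + 1)) (one_sub_dvd_one_sub_pow q (k + 1))
  have h := hdvd N 0
  rw [hq, zero_dvd_iff, sub_eq_zero, qHomogSum_zero, hb0] at h
  exact h

lemma sum_ascN_eq_sum_repN {t u : A} {N : ℕ} (ht : t ^ N = 0) (hu : IsNilpotent u) :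
    ∑ n ∈ Finset.range N, ∑ s ∈ ascentSeqs n, t ^ (n + 1) * u ^ (ascN s + 1) =
      ∑ n ∈ Finset.range N, ∑ s ∈ ascentSeqs n, t ^ (n + 1) * u ^ (repN s + 1) := by
  have hq : (1 - (1 - t)) ^ N = 0 := by rwa [sub_sub_cancel]
  have h1 := sum_ascN_eq_qSum hq hu
  rw [← sum_repN_eq_qSum hq u, sub_sub_cancel] at h1
  rw [h1]
  simp only [Finset.mul_sum]
  exact Finset.sum_congr rfl fun n _ => Finset.sum_congr rfl fun s _ => by ring

end GeneratingFunctions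

section Extraction

open Polynomial

lemma coeff_coeff_sum_ascentSeqs {N m : ℕ} (hm : m < N) (f : List ℕ → ℕ) (k : ℕ) :
    ((∑ n ∈ Finset.range N, ∑ s ∈ ascentSeqs n,
      (X : ℤ[X][X]) ^ (n + 1) * C (X ^ (f s + 1))).coeff (m + 1)).coeff (k + 1) =
      (((ascentSeqs m).filter fun s => f s = k).card : ℤ) := by
  have hterm : ∀ n j, (((X : ℤ[X][X]) ^ (n + 1) * C (X ^ (j + 1))).coeff (m + 1)).coeff (k + 1) =
      if m = n then if j = k then 1 else 0 else 0 := by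
    intro n j
    rw [coeff_mul_C, coeff_X_pow]
    split_ifs <;> simp_all [coeff_X_pow, eq_comm]
  simp only [finsetSum_coeff, hterm]
  rw [Finset.sum_eq_single_of_mem m (Finset.mem_range.2 hm)]
  · simp
  · intro n _ hn
    simp [hn.symm]

lemma card_filter_ascN_eq_card_filter_repN (m k : ℕ) :
    ((ascentSeqs m).filter fun s => ascN s = k).card =
      ((ascentSeqs m).filter fun s => repN s = k).card := by
  set N := m + k + 2 with hN
  let I : Ideal ℤ[X][X] := Ideal.span {X ^ N, C X ^ N}
  let π := Ideal.Quotient.mk I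
  have ht : π X ^ N = 0 := by
    rw [← map_pow, Ideal.Quotient.eq_zero_iff_mem]
    exact Ideal.subset_span (by simp)
  have hu : π (C X) ^ N = 0 := by
    rw [← map_pow, Ideal.Quotient.eq_zero_iff_mem]
    exact Ideal.subset_span (by simp)
  have h := sum_ascN_eq_sum_repN (A := ℤ[X][X] ⧸ I) ht ⟨N, hu⟩
  simp only [← map_pow, ← map_mul, ← map_sum] at h
  rw [Ideal.Quotient.eq, Ideal.mem_span_pair] at h
  obtain ⟨a, b, hab⟩ := h
  have hcoeff := congrArg (fun p : ℤ[X][X] => (p.coeff (m + 1)).coeff (k + 1)) hab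
  simp only [coeff_add, coeff_sub] at hcoeff
  rw [coeff_coeff_sum_ascentSeqs (by omega), coeff_coeff_sum_ascentSeqs (by omega),
    coeff_mul_X_pow', if_neg (by omega), ← C_pow, coeff_mul_C, coeff_mul_X_pow',
    if_neg (by omega), coeff_zero, add_zero] at hcoeff
  exact_mod_cast (sub_eq_zero.1 hcoeff.symm)

lemma ncard_ascSeqs_eq (m k : ℕ) (f : List ℕ → ℕ) :
    {s : List ℕ | IsAscSeq s ∧ s.length = m + 1 ∧ f s = k}.ncard =
      ((ascentSeqs m).filter fun s => f s = k).card := by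
  rw [← Set.ncard_coe_finset]
  congr 1
  ext s
  simp [mem_ascentSeqs, and_assoc]

end Extraction

/-- `rep` is an Eulerian statistic on ascent sequences: for every `n ≥ 1` and `k`,
ascent sequences of length `n` with `k` ascents are equinumerous with those with
`k` repeated entries. -/
theorem rep_is_Eulerian (n : ℕ) (hn : 1 ≤ n) (k : ℕ) :
    {s : List ℕ | IsAscSeq s ∧ s.length = n ∧ ascN s = k}.ncard =
    {s : List ℕ | IsAscSeq s ∧ s.length = n ∧ repN s = k}.ncard := by
  obtain ⟨m, rfl⟩ := Nat.exists_eq_add_of_le' hn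
  rw [ncard_ascSeqs_eq, ncard_ascSeqs_eq, card_filter_ascN_eq_card_filter_repN]
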